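/- arXiv:math/0405477 — 5 statements merged into one kernel-verified Lean document; each statement's English description precedes it below -/
import Mathlib

section
/- In R = U[[h]], with H := S·J₀, one has H·T - T·H = T² - 1 and H·T⁻¹ - T⁻¹·H = T⁻² - 1. -/
/-- The generalized binomial coefficient `α(α-1)⋯(α-n+1)/n!`. -/
noncomputable def qbinom (α : ℚ) (n : ℕ) : ℚ :=
  (∏ i ∈ Finset.range n, (α - (i : ℚ))) / (n.factorial : ℚ)

/-- `S := Σ_{n≥0} binom(1/2,n) h^{2n} u^{2n}` in `A[[h]]`. -/
noncomputable def sqrtSer {A : Type*} [Ring A] [Algebra ℂ A] (u : A) : PowerSeries A :=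
  PowerSeries.mk fun m =>
    if m % 2 = 0 then ((qbinom (1/2) (m / 2) : ℚ) : ℂ) • u ^ m else 0

/-- `T := h·u + S`. -/
noncomputable def Tser {A : Type*} [Ring A] [Algebra ℂ A] (u : A) : PowerSeries A :=
  PowerSeries.X * PowerSeries.C u + sqrtSer u

/-- `T⁻¹ := -h·u + S`. -/
noncomputable def Tinvser {A : Type*} [Ring A] [Algebra ℂ A] (u : A) : PowerSeries A :=
  -(PowerSeries.X * PowerSeries.C u) + sqrtSer u

/-- `H := S·J₀`. -/
noncomputable def Hser {A : Type*} [Ring A] [Algebra ℂ A] (u J0 : A) : PowerSeries A :=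
  sqrtSer u * PowerSeries.C J0

theorem qbinom_eq_choose (α : ℚ) (n : ℕ) : qbinom α n = Ring.choose α n := by
  rw [Ring.choose_eq_smul, ← Polynomial.aeval_eq_smeval, ← Polynomial.eval_map_algebraMap,
    descPochhammer_map]
  simp [qbinom, descPochhammer_eval_eq_prod_range, div_eq_inv_mul]

/-- The ring homomorphism `f(X) ↦ f(h·u)` from `ℂ[[X]]` to `A[[h]]`. -/
noncomputable def evalScaled {A : Type*} [Ring A] [Algebra ℂ A] (u : A) :
    PowerSeries ℂ →+* PowerSeries A where
  toFun f := PowerSeries.mk fun n => PowerSeries.coeff n f • u ^ n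
  map_one' := by
    ext n
    by_cases hn : n = 0 <;> simp [PowerSeries.coeff_one, hn]
  map_zero' := by
    ext n
    simp
  map_add' f g := by
    ext n
    simp [add_smul]
  map_mul' f g := by
    ext n
    simp only [PowerSeries.coeff_mk, PowerSeries.coeff_mul, Finset.sum_smul]
    refine Finset.sum_congr rfl fun p hp => ?_
    rw [smul_mul_smul_comm, ← pow_add, Finset.HasAntidiagonal.mem_antidiagonal.mp hp]

/-- The power series of `√(1 + X²)`. -/
noncomputable def sqrtOneAddSq : PowerSeries ℂ :=
  PowerSeries.expand 2 two_ne_zero (PowerSeries.binomialSeries ℂ (1 / 2 : ℚ))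

theorem sqrtOneAddSq_mul_self : sqrtOneAddSq * sqrtOneAddSq = 1 + PowerSeries.X ^ 2 := by
  have h := PowerSeries.binomialSeries_nat (R := ℚ) (A := ℂ) 1
  rw [sqrtOneAddSq, ← map_mul, ← PowerSeries.binomialSeries_add, add_halves,
    ← Nat.cast_one (R := ℚ), h]
  simp

theorem sqrtOneAddSq_mul_derivative :
    sqrtOneAddSq * PowerSeries.derivative ℂ sqrtOneAddSq = PowerSeries.X := by
  have h := congrArg (PowerSeries.derivative ℂ) sqrtOneAddSq_mul_self
  simp only [Derivation.leibniz, map_add, PowerSeries.derivative_one, smul_eq_mul,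
    PowerSeries.derivative_pow, PowerSeries.derivative_X] at h
  have h2 : (2 : PowerSeries ℂ) ≠ 0 := fun h0 => by
    simpa using (map_ofNat (PowerSeries.constantCoeff (R := ℂ)) 2).symm.trans (congrArg _ h0)
  apply mul_left_cancel₀ h2
  norm_num at h
  linear_combination h

/-- With `S = √(1 + X²)`, both `T = X + S` and `T = -X + S` solve `2·S·X·T' = T² - 1`. -/
theorem sq_sub_one_eq :
    (PowerSeries.X + sqrtOneAddSq) ^ 2 - 1 = sqrtOneAddSq *
      (2 * PowerSeries.X * PowerSeries.derivative ℂ (PowerSeries.X + sqrtOneAddSq)) ∧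
    (-PowerSeries.X + sqrtOneAddSq) ^ 2 - 1 = sqrtOneAddSq *
      (2 * PowerSeries.X * PowerSeries.derivative ℂ (-PowerSeries.X + sqrtOneAddSq)) := by
  have h1 := sqrtOneAddSq_mul_self
  have h2 := sqrtOneAddSq_mul_derivative
  simp only [map_add, map_neg, PowerSeries.derivative_X]
  constructor <;> linear_combination h1 - 2 * PowerSeries.X * h2

section

variable {A : Type*} [Ring A] [Algebra ℂ A]

theorem coeff_evalScaled (u : A) (f : PowerSeries ℂ) (n : ℕ) :
    PowerSeries.coeff n (evalScaled u f) = PowerSeries.coeff n f • u ^ n :=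
  PowerSeries.coeff_mk n fun n => PowerSeries.coeff n f • u ^ n

theorem evalScaled_X (u : A) :
    evalScaled u PowerSeries.X = PowerSeries.X * PowerSeries.C u := by
  ext n
  rw [coeff_evalScaled]
  rcases n with _ | _ | n <;> simp [PowerSeries.coeff_X]

theorem sqrtSer_eq_evalScaled (u : A) : sqrtSer u = evalScaled u sqrtOneAddSq := by
  ext n
  rw [coeff_evalScaled, sqrtSer, PowerSeries.coeff_mk, sqrtOneAddSq]
  split_ifs with hn
  · obtain ⟨k, rfl⟩ := Nat.dvd_of_mod_eq_zero hn
    rw [PowerSeries.coeff_expand_mul, PowerSeries.binomialSeries_coeff, qbinom_eq_choose,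
      Nat.mul_div_cancel_left k two_pos, Rat.smul_one_eq_cast]
  · rw [PowerSeries.coeff_expand_of_not_dvd _ _ _ (mt Nat.mod_eq_zero_of_dvd hn), zero_smul]

theorem Tser_eq_evalScaled (u : A) :
    Tser u = evalScaled u (PowerSeries.X + sqrtOneAddSq) := by
  rw [Tser, map_add, evalScaled_X, sqrtSer_eq_evalScaled]

theorem Tinvser_eq_evalScaled (u : A) :
    Tinvser u = evalScaled u (-PowerSeries.X + sqrtOneAddSq) := by
  rw [Tinvser, map_add, map_neg, evalScaled_X, sqrtSer_eq_evalScaled]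

theorem commutator_pow {J u : A} (h : J * u - u * J = 2 * u) (n : ℕ) :
    J * u ^ n - u ^ n * J = (2 * n : ℂ) • u ^ n := by
  induction n with
  | zero => simp
  | succ n ih =>
    have key : J * u ^ (n + 1) - u ^ (n + 1) * J =
        (J * u ^ n - u ^ n * J) * u + u ^ n * (J * u - u * J) := by
      rw [pow_succ]
      noncomm_ring
    have two : (2 : A) * u = (2 : ℂ) • u := by rw [two_mul, two_smul]
    rw [key, ih, h, two, mul_smul_comm, smul_mul_assoc, ← pow_succ, ← add_smul]
    push_cast
    ring_nf

theorem commutator_C_evalScaled {J u : A} (h : J * u - u * J = 2 * u) (f : PowerSeries ℂ) :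
    PowerSeries.C J * evalScaled u f - evalScaled u f * PowerSeries.C J =
      evalScaled u (2 * PowerSeries.X * PowerSeries.derivative ℂ f) := by
  ext n
  rw [map_sub, PowerSeries.coeff_C_mul, PowerSeries.coeff_mul_C, coeff_evalScaled,
    coeff_evalScaled, mul_smul_comm, smul_mul_assoc, ← smul_sub, commutator_pow h, smul_smul,
    mul_assoc, two_mul, two_mul (PowerSeries.X * _), map_add]
  congr 1
  cases n with
  | zero => simp
  | succ n =>
    rw [PowerSeries.coeff_succ_X_mul, PowerSeries.coeff_derivative]
    push_cast
    ring

theorem commutator_evalScaled {J u : A} (h : J * u - u * J = 2 * u) (s f : PowerSeries ℂ) :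
    evalScaled u s * PowerSeries.C J * evalScaled u f -
        evalScaled u f * (evalScaled u s * PowerSeries.C J) =
      evalScaled u (s * (2 * PowerSeries.X * PowerSeries.derivative ℂ f)) := by
  rw [map_mul, ← commutator_C_evalScaled h, ← mul_assoc (evalScaled u f), ← map_mul,
    mul_comm f s, map_mul, mul_sub, mul_assoc, mul_assoc]

end

/-- In `R = U[[h]]`, with `H := S·J₀`, one has `H·T - T·H = T² - 1` and
`H·T⁻¹ - T⁻¹·H = T⁻² - 1`.  `U` (the universal enveloping algebra of `sl(2,ℂ)`,
generated by `J₀, J₊, J₋` subject only to the stated relations) is formalized by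
quantifying over all unital associative `ℂ`-algebras containing such elements. -/
theorem statement_1 (A : Type*) [Ring A] [Algebra ℂ A] (J0 Jp Jm : A)
    (rel1 : J0 * Jp - Jp * J0 = 2 * Jp)
    (rel2 : J0 * Jm - Jm * J0 = -(2 * Jm))
    (rel3 : Jp * Jm - Jm * Jp = J0) :
    Hser Jp J0 * Tser Jp - Tser Jp * Hser Jp J0 = Tser Jp ^ 2 - 1 ∧
    Hser Jp J0 * Tinvser Jp - Tinvser Jp * Hser Jp J0 = Tinvser Jp ^ 2 - 1 := by
  obtain ⟨hT, hT'⟩ := sq_sub_one_eq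
  rw [Hser, Tser_eq_evalScaled, Tinvser_eq_evalScaled, sqrtSer_eq_evalScaled]
  constructor
  · rw [commutator_evalScaled rel1, ← map_pow, ← map_one (evalScaled Jp), ← map_sub, hT]
  · rw [commutator_evalScaled rel1, ← map_pow, ← map_one (evalScaled Jp), ← map_sub, hT']
end

section
/- In R = U[[h]], with H := S·J₀ and Y := J₋ - (h²/4)·J₊·(J₀² - 1), one has H·Y - Y·H = -(1/2)(Y·(T + T⁻¹) + (T + T⁻¹)·Y); that is, [H,Y] = -Y·cosh(hX) - cosh(hX)·Y where cosh(hX) = (T+T⁻¹)/2. -/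
/-- `Y := J₋ - (h²/4)·J₊·(J₀² - 1)`. -/
noncomputable def Yser {A : Type*} [Ring A] [Algebra ℂ A] (J0 Jp Jm : A) : PowerSeries A :=
  PowerSeries.C Jm -
    (1/4 : ℂ) • (PowerSeries.X ^ 2 * PowerSeries.C (Jp * (J0 ^ 2 - 1)))

open PowerSeries in
theorem coeff_sqrtSer {A : Type*} [Ring A] [Algebra ℂ A] (u : A) (m : ℕ) :
    coeff m (sqrtSer u) =
      (if m % 2 = 0 then ((qbinom (1/2) (m / 2) : ℚ) : ℂ) else 0) • u ^ m := by
  simp only [sqrtSer, coeff_mk]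
  split_ifs <;> simp

theorem qbinom_succ (α : ℚ) (n : ℕ) :
    ((n : ℚ) + 1) * qbinom α (n + 1) = (α - n) * qbinom α n := by
  have h1 : (n.factorial : ℚ) ≠ 0 := by exact_mod_cast n.factorial_ne_zero
  have h2 : (n : ℚ) + 1 ≠ 0 := by positivity
  simp only [qbinom, Finset.prod_range_succ, Nat.factorial_succ, Nat.cast_mul, Nat.cast_add,
    Nat.cast_one]
  field_simp

/-- The differential equation `(1 + h²u²) S' = h²u S` on coefficients. -/
theorem sqrtSer_coeff_rec (m : ℕ) :
    ((m : ℂ) + 2) *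
        (if (m + 2) % 2 = 0 then ((qbinom (1/2) ((m + 2) / 2) : ℚ) : ℂ) else 0) =
      (1 - (m : ℂ)) * (if m % 2 = 0 then ((qbinom (1/2) (m / 2) : ℚ) : ℂ) else 0) := by
  rcases Nat.even_or_odd' m with ⟨k, rfl | rfl⟩
  · have h := congrArg (fun q : ℚ => (q : ℂ)) (qbinom_succ (1/2) k)
    have e1 : (2 * k + 2) / 2 = k + 1 := by omega
    have e2 : (2 * k) / 2 = k := by omega
    have e3 : (2 * k + 2) % 2 = 0 := by omega
    have e4 : (2 * k) % 2 = 0 := by omega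
    rw [e1, e2, if_pos e3, if_pos e4]
    push_cast at h ⊢
    linear_combination 2 * h
  · have e3 : (2 * k + 1 + 2) % 2 ≠ 0 := by omega
    have e4 : (2 * k + 1) % 2 ≠ 0 := by omega
    rw [if_neg e3, if_neg e4, mul_zero, mul_zero]

theorem mul_pow_of_weight_two {A : Type*} [Ring A] {J0 Jp : A}
    (h : J0 * Jp - Jp * J0 = 2 * Jp) (n : ℕ) :
    J0 * Jp ^ n = Jp ^ n * (J0 + 2 * (n : A)) := by
  induction n with
  | zero => simp
  | succ n ih =>
    have h' : J0 * Jp = Jp * (J0 + 2) := by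
      rw [sub_eq_iff_eq_add.mp h]; noncomm_ring
    have e : (2 * (n : A)) * Jp = Jp * (2 * (n : A)) := by
      have := Nat.cast_commute (2 * n) Jp
      push_cast at this
      exact this.eq
    rw [pow_succ, ← mul_assoc, ih, mul_assoc, add_mul, h', e, ← mul_add, ← mul_assoc]
    push_cast
    noncomm_ring

theorem pow_succ_commutator {A : Type*} [Ring A] {J0 Jp Jm : A}
    (h1 : J0 * Jp - Jp * J0 = 2 * Jp) (h3 : Jp * Jm - Jm * Jp = J0) (n : ℕ) :
    Jp ^ (n + 1) * Jm - Jm * Jp ^ (n + 1) = ((n : A) + 1) * (Jp ^ n * (J0 + (n : A))) := by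
  induction n with
  | zero => simpa using h3
  | succ n ih =>
    have e : Jp ^ (n + 2) * Jm - Jm * Jp ^ (n + 2) =
        Jp * (Jp ^ (n + 1) * Jm - Jm * Jp ^ (n + 1)) +
          (Jp * Jm - Jm * Jp) * Jp ^ (n + 1) := by
      rw [pow_succ' Jp (n + 1)]; noncomm_ring
    have c : ∀ x : A, (n : A) * x = x * (n : A) := fun x => (Nat.cast_commute n x).eq
    rw [e, ih, h3, mul_pow_of_weight_two h1, pow_succ' Jp n]
    push_cast
    simp only [add_mul, mul_add, c, mul_assoc, one_mul, mul_one, two_mul]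
    noncomm_ring

open PowerSeries in
theorem sqrtSer_commutator_Yser {A : Type*} [Ring A] [Algebra ℂ A] {J0 Jp Jm : A}
    (h1 : J0 * Jp - Jp * J0 = 2 * Jp) (h3 : Jp * Jm - Jm * Jp = J0) :
    sqrtSer Jp * Yser J0 Jp Jm - Yser J0 Jp Jm * sqrtSer Jp =
      X ^ 2 * (sqrtSer Jp * C (Jp * (J0 + 1))) := by
  have hX : sqrtSer Jp * X ^ 2 = X ^ 2 * sqrtSer Jp := ((commute_X _).pow_right 2).eq
  have key : sqrtSer Jp * Yser J0 Jp Jm - Yser J0 Jp Jm * sqrtSer Jp =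
      (sqrtSer Jp * C Jm - C Jm * sqrtSer Jp) - (1/4 : ℂ) •
        (X ^ 2 * (sqrtSer Jp * C (Jp * (J0 ^ 2 - 1)) - C (Jp * (J0 ^ 2 - 1)) * sqrtSer Jp)) := by
    simp only [Yser, mul_sub, sub_mul, mul_smul_comm, smul_mul_assoc, ← mul_assoc, hX, smul_sub]
    abel
  have hs : ∀ (c : ℂ) (n : ℕ) (f : PowerSeries A), coeff n (c • f) = c • coeff n f :=
    fun _ _ _ => rfl
  rw [key]
  ext n
  simp only [map_sub, hs, coeff_X_pow_mul', coeff_mul_C, coeff_C_mul, coeff_sqrtSer]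
  match n with
  | 0 => simp
  | 1 => simp
  | n + 2 =>
    have hr := sqrtSer_coeff_rec n
    have h2 : 2 ≤ n + 2 := by omega
    rw [if_pos h2, if_pos h2, Nat.add_sub_cancel]
    generalize (if (n + 2) % 2 = 0 then ((qbinom (1/2) ((n + 2) / 2) : ℚ) : ℂ) else 0) = b at *
    generalize (if n % 2 = 0 then ((qbinom (1/2) (n / 2) : ℚ) : ℂ) else 0) = a at *
    have hc := pow_succ_commutator h1 h3 (n + 1)
    have c : ∀ x : A, (n : A) * x = (n : ℂ) • x := fun x => by
      rw [Algebra.smul_def, map_natCast]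
    have c' : ∀ x : A, x * (n : A) = (n : ℂ) • x := fun x => by
      rw [← c, (Nat.cast_commute n x).eq]
    have hq : J0 * Jp ^ n = Jp ^ n * J0 + (2 * n : ℂ) • Jp ^ n := by
      rw [mul_pow_of_weight_two h1, mul_add, two_mul, mul_add, c']
      module
    have hq2 : Jp * (J0 ^ 2 - 1) * Jp ^ n =
        Jp ^ (n + 1) * (J0 * J0) + (4 * n : ℂ) • (Jp ^ (n + 1) * J0) +
          ((4 * n * n : ℂ) - 1) • Jp ^ (n + 1) := by
      have : Jp * (J0 ^ 2 - 1) * Jp ^ n = Jp * (J0 * (J0 * Jp ^ n)) - Jp * Jp ^ n := by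
        noncomm_ring
      rw [this, hq, mul_add J0, mul_smul_comm, ← mul_assoc J0, hq, pow_succ']
      simp only [mul_add, add_mul, mul_assoc, mul_smul_comm, smul_mul_assoc]
      module
    have hc2 : Jp ^ (n + 2) * Jm - Jm * Jp ^ (n + 2) =
        ((n : ℂ) + 2) • (Jp ^ (n + 1) * J0 + ((n : ℂ) + 1) • Jp ^ (n + 1)) := by
      rw [hc]
      push_cast
      simp only [mul_add, add_mul, c, c', one_mul, mul_one]
      module
    have hq3 : Jp ^ n * (Jp * (J0 ^ 2 - 1)) = Jp ^ (n + 1) * (J0 * J0) - Jp ^ (n + 1) := by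
      rw [← mul_assoc, ← pow_succ, mul_sub, mul_one, sq]
    have hq4 : Jp ^ n * (Jp * (J0 + 1)) = Jp ^ (n + 1) * J0 + Jp ^ (n + 1) := by
      rw [← mul_assoc, ← pow_succ, mul_add, mul_one]
    rw [smul_mul_assoc, mul_smul_comm, ← smul_sub, hc2, smul_mul_assoc, mul_smul_comm, hq2, hq3,
      smul_mul_assoc, hq4]
    linear_combination (norm := module)
      hr • (Jp ^ (n + 1) * J0 + ((n : ℂ) + 1) • Jp ^ (n + 1))

open PowerSeries in
theorem commutator_C_Yser {A : Type*} [Ring A] [Algebra ℂ A] {J0 Jp Jm : A}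
    (h1 : J0 * Jp - Jp * J0 = 2 * Jp) (h2 : J0 * Jm - Jm * J0 = -(2 * Jm)) :
    C J0 * Yser J0 Jp Jm - Yser J0 Jp Jm * C J0 =
      -((2 : ℂ) • Yser J0 Jp Jm) - X ^ 2 * C (Jp * (J0 ^ 2 - 1)) := by
  have hX : C J0 * X ^ 2 = X ^ 2 * C J0 := ((commute_X _).pow_right 2).eq
  have key : C J0 * Yser J0 Jp Jm - Yser J0 Jp Jm * C J0 =
      C (J0 * Jm - Jm * J0) - (1/4 : ℂ) •
        (X ^ 2 * C (J0 * (Jp * (J0 ^ 2 - 1)) - Jp * (J0 ^ 2 - 1) * J0)) := by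
    simp only [Yser, mul_sub, sub_mul, mul_smul_comm, smul_mul_assoc, map_sub, map_mul,
      ← mul_assoc, hX, smul_sub]
    abel
  have e : J0 * (Jp * (J0 ^ 2 - 1)) - Jp * (J0 ^ 2 - 1) * J0 =
      Jp * (J0 ^ 2 - 1) + Jp * (J0 ^ 2 - 1) := by
    have : J0 * (Jp * (J0 ^ 2 - 1)) - Jp * (J0 ^ 2 - 1) * J0 =
        (J0 * Jp - Jp * J0) * (J0 ^ 2 - 1) := by noncomm_ring
    rw [this, h1]; noncomm_ring
  rw [key, e, h2, two_mul, Yser]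
  simp only [map_neg, map_add, mul_add]
  module

/-- In `R = U[[h]]`: `[H,Y] = -(1/2)(Y·(T+T⁻¹) + (T+T⁻¹)·Y)`, i.e.
`[H,Y] = -Y·cosh(hX) - cosh(hX)·Y` with `cosh(hX) = (T+T⁻¹)/2`.  `U` (the universal
enveloping algebra of `sl(2,ℂ)`, generated by `J₀, J₊, J₋` subject only to the stated
relations) is formalized by quantifying over all unital associative `ℂ`-algebras
containing such elements. -/
theorem statement_3 (A : Type*) [Ring A] [Algebra ℂ A] (J0 Jp Jm : A)
    (rel1 : J0 * Jp - Jp * J0 = 2 * Jp)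
    (rel2 : J0 * Jm - Jm * J0 = -(2 * Jm))
    (rel3 : Jp * Jm - Jm * Jp = J0) :
    Hser Jp J0 * Yser J0 Jp Jm - Yser J0 Jp Jm * Hser Jp J0 =
      -((1/2 : ℂ) • (Yser J0 Jp Jm * (Tser Jp + Tinvser Jp) +
          (Tser Jp + Tinvser Jp) * Yser J0 Jp Jm)) := by
  have hT : Tser Jp + Tinvser Jp = (2 : ℂ) • sqrtSer Jp := by
    rw [Tser, Tinvser]; module
  have hS := sqrtSer_commutator_Yser rel1 rel3
  have hJ := commutator_C_Yser rel1 rel2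
  have hX : sqrtSer Jp * PowerSeries.X ^ 2 = PowerSeries.X ^ 2 * sqrtSer Jp :=
    ((PowerSeries.commute_X _).pow_right 2).eq
  have hfac : PowerSeries.C (Jp * (J0 ^ 2 - 1)) =
      PowerSeries.C (Jp * (J0 + 1)) * (PowerSeries.C J0 - 1) := by
    rw [← map_one PowerSeries.C, ← map_sub, ← map_mul]
    congr 1
    noncomm_ring
  have hSJ : sqrtSer Jp * (PowerSeries.X ^ 2 * PowerSeries.C (Jp * (J0 ^ 2 - 1))) =
      (sqrtSer Jp * Yser J0 Jp Jm - Yser J0 Jp Jm * sqrtSer Jp) * (PowerSeries.C J0 - 1) := by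
    rw [hS, hfac, ← mul_assoc, hX]
    simp only [mul_assoc]
  have split : Hser Jp J0 * Yser J0 Jp Jm - Yser J0 Jp Jm * Hser Jp J0 =
      sqrtSer Jp * (PowerSeries.C J0 * Yser J0 Jp Jm - Yser J0 Jp Jm * PowerSeries.C J0) +
        (sqrtSer Jp * Yser J0 Jp Jm - Yser J0 Jp Jm * sqrtSer Jp) * PowerSeries.C J0 := by
    rw [Hser]; noncomm_ring
  rw [split, hJ, mul_sub, hSJ, hT, mul_sub _ (PowerSeries.C J0), mul_one, mul_neg]
  simp only [mul_smul_comm, smul_mul_assoc]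
  module
end

section
/- In R = U[[h]], with X := Σ_{n≥0} ((-1)ⁿ (2n)! / (4ⁿ (n!)² (2n+1))) h^{2n} J₊^{2n+1}, H := S·J₀ and Y := J₋ - (h²/4)·J₊·(J₀² - 1), one has X·Y - Y·X = H. (Together with the previous relations this shows that (H, X, Y) realize Ohn's Jordanian algebra U_h(sl(2)) inside U(sl(2,ℂ))[[h]] via a nonlinear map.) -/
/-- The coefficients `(-1)ⁿ (2n)! / (4ⁿ (n!)² (2n+1))` of the arcsinh series. -/
noncomputable def arcsinhCoeff (n : ℕ) : ℚ :=
  ((-1 : ℚ)) ^ n * ((2 * n).factorial : ℚ) /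
    ((4 : ℚ) ^ n * ((n.factorial : ℚ)) ^ 2 * (2 * n + 1 : ℚ))

/-- `X := Σ_{n≥0} (-1)ⁿ(2n)!/(4ⁿ(n!)²(2n+1)) h^{2n} J₊^{2n+1}`, the formal series for
`h⁻¹·arcsinh(h·J₊)` as an element of `A[[h]]`. -/
noncomputable def arcsinhSer {A : Type*} [Ring A] [Algebra ℂ A] (u : A) : PowerSeries A :=
  PowerSeries.mk fun m =>
    if m % 2 = 0 then ((arcsinhCoeff (m / 2) : ℚ) : ℂ) • u ^ (m + 1) else 0

theorem arcsinhCoeff_succ (n : ℕ) :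
    (2 * n + 3 : ℚ) * (2 * n + 2) * arcsinhCoeff (n + 1) = -(2 * n + 1) ^ 2 * arcsinhCoeff n := by
  have h1 : (2 * n + 1 : ℚ) ≠ 0 := by positivity
  have h2 : (2 * n + 3 : ℚ) ≠ 0 := by positivity
  have h3 : (n + 1 : ℚ) ≠ 0 := by positivity
  have h4 : (n.factorial : ℚ) ≠ 0 := by positivity
  have h5 : (2 * ((n : ℚ) + 1) + 1) ≠ 0 := by positivity
  unfold arcsinhCoeff
  rw [show 2 * (n + 1) = 2 * n + 1 + 1 by ring, Nat.factorial_succ, Nat.factorial_succ,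
    Nat.factorial_succ]
  push_cast
  field_simp
  ring

theorem qbinom_succ_mul (α : ℚ) (n : ℕ) :
    qbinom α (n + 1) * (n + 1) = qbinom α n * (α - n) := by
  have h3 : (n + 1 : ℚ) ≠ 0 := by positivity
  have h4 : (n.factorial : ℚ) ≠ 0 := by positivity
  unfold qbinom
  rw [Finset.prod_range_succ, Nat.factorial_succ]
  push_cast
  field_simp

theorem one_sub_mul_qbinom_half (n : ℕ) :
    (1 - 2 * n : ℚ) * qbinom (1 / 2) n = (2 * n + 1) * arcsinhCoeff n := by
  induction n with
  | zero => simp [qbinom, arcsinhCoeff]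
  | succ n ih =>
    have h3 : (2 * n + 2 : ℚ) ≠ 0 := by positivity
    apply mul_left_cancel₀ h3
    push_cast
    linear_combination (-(2 * n + 1) : ℚ) * ih - arcsinhCoeff_succ n
      - 2 * (2 * n + 1 : ℚ) * qbinom_succ_mul (1 / 2) n

theorem qbinom_half_succ (n : ℕ) :
    qbinom (1 / 2) (n + 1) = (2 * n + 3) * arcsinhCoeff (n + 1) + (2 * n + 1) * arcsinhCoeff n := by
  have h1 : (2 * n + 1 : ℚ) ≠ 0 := by positivity
  apply mul_left_cancel₀ h1
  have h := one_sub_mul_qbinom_half (n + 1)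
  push_cast at h
  linear_combination -h - arcsinhCoeff_succ n

section Commutation

variable {A : Type*} [Ring A] {J0 Jp Jm : A}

theorem cartan_mul_raising_pow (rel1 : J0 * Jp - Jp * J0 = 2 * Jp) (k : ℕ) :
    J0 * Jp ^ k = Jp ^ k * (J0 + 2 * k) := by
  induction k with
  | zero => simp
  | succ k ih =>
    have h : J0 * Jp = Jp * (J0 + 2) := by
      rw [mul_add, mul_two, ← two_mul, ← rel1]; abel
    have hc : (2 * (k : A)) * Jp = Jp * (2 * k) := by
      exact_mod_cast (Nat.cast_commute (2 * k) Jp).eq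
    rw [pow_succ, ← mul_assoc, ih, mul_assoc, add_mul, h, hc, ← mul_add, ← mul_assoc]
    push_cast
    noncomm_ring

theorem raising_pow_succ_commutator_lowering (rel1 : J0 * Jp - Jp * J0 = 2 * Jp)
    (rel3 : Jp * Jm - Jm * Jp = J0) (k : ℕ) :
    Jp ^ (k + 1) * Jm - Jm * Jp ^ (k + 1) = (k + 1 : ℕ) • (Jp ^ k * (J0 + k)) := by
  induction k with
  | zero => simpa using rel3
  | succ k ih =>
    have e : Jp ^ (k + 1 + 1) * Jm - Jm * Jp ^ (k + 1 + 1) =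
        Jp * (Jp ^ (k + 1) * Jm - Jm * Jp ^ (k + 1)) + (Jp * Jm - Jm * Jp) * Jp ^ (k + 1) := by
      rw [pow_succ' Jp (k + 1)]; noncomm_ring
    rw [e, ih, rel3, cartan_mul_raising_pow rel1, mul_smul_comm, ← mul_assoc, ← pow_succ']
    simp only [nsmul_eq_mul, mul_add, Nat.cast_add, Nat.cast_one, add_mul, one_mul, mul_one,
      two_mul]
    have c := Nat.cast_commute k (Jp ^ (k + 1))
    have c' : (k : A) * (Jp ^ (k + 1) * k) = Jp ^ (k + 1) * k * k := by
      rw [← mul_assoc, c.eq]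
    have c'' : (k : A) * (Jp ^ (k + 1) * J0) = Jp ^ (k + 1) * (k * J0) := by
      rw [← mul_assoc, c.eq, mul_assoc]
    simp only [c', c'', c.eq]
    noncomm_ring

theorem raising_pow_commutator_cartan_sq (rel1 : J0 * Jp - Jp * J0 = 2 * Jp) (k : ℕ) :
    Jp ^ k * (Jp * (J0 ^ 2 - 1)) - Jp * (J0 ^ 2 - 1) * Jp ^ k =
      -((4 * k : ℕ) • (Jp ^ (k + 1) * (J0 + k))) := by
  have h := cartan_mul_raising_pow rel1 k
  have h2 : J0 ^ 2 * Jp ^ k = Jp ^ k * (J0 + 2 * k) ^ 2 := by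
    rw [pow_two, mul_assoc, h, ← mul_assoc, h, mul_assoc, ← pow_two]
  have c := Nat.cast_commute k J0
  have hs : (J0 + 2 * (k : A)) ^ 2 = J0 ^ 2 + (4 * k : ℕ) • (J0 + k) := by
    simp only [pow_two, nsmul_eq_mul, Nat.cast_mul, Nat.cast_ofNat, mul_add, add_mul, mul_assoc]
    rw [show (2 : A) = ((2 : ℕ) : A) by norm_num, show (4 : A) = ((4 : ℕ) : A) by norm_num]
    simp only [← nsmul_eq_mul, mul_smul_comm]
    rw [← c.eq, ← nsmul_eq_mul, ← nsmul_one k]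
    module
  rw [mul_assoc Jp, sub_mul, h2, hs, ← mul_assoc, ← pow_succ, pow_succ']
  simp only [mul_smul_comm, mul_add, mul_sub, one_mul, mul_one, ← mul_assoc, smul_add]
  abel

end Commutation

/-- In `R = U[[h]]`: `X·Y - Y·X = H`, completing the nonlinear realization of Ohn's
Jordanian algebra `U_h(sl(2))` inside `U(sl(2,ℂ))[[h]]`.  `U` (the universal enveloping
algebra of `sl(2,ℂ)`, generated by `J₀, J₊, J₋` subject only to the stated relations)
is formalized by quantifying over all unital associative `ℂ`-algebras containing such
elements. -/
theorem statement_4 (A : Type*) [Ring A] [Algebra ℂ A] (J0 Jp Jm : A)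
    (rel1 : J0 * Jp - Jp * J0 = 2 * Jp)
    (rel2 : J0 * Jm - Jm * J0 = -(2 * Jm))
    (rel3 : Jp * Jm - Jm * Jp = J0) :
    arcsinhSer Jp * Yser J0 Jp Jm - Yser J0 Jp Jm * arcsinhSer Jp = Hser Jp J0 := by
  obtain ⟨W, hW⟩ : ∃ W, W = Jp * (J0 ^ 2 - 1) := ⟨_, rfl⟩
  have hx : arcsinhSer Jp * (PowerSeries.X ^ 2 * PowerSeries.C W) =
      PowerSeries.X ^ 2 * (arcsinhSer Jp * PowerSeries.C W) := by
    rw [← mul_assoc, ← PowerSeries.X_pow_mul, mul_assoc]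
  have hs : arcsinhSer Jp * Yser J0 Jp Jm - Yser J0 Jp Jm * arcsinhSer Jp =
      (arcsinhSer Jp * PowerSeries.C Jm - PowerSeries.C Jm * arcsinhSer Jp) -
      (1 / 4 : ℂ) • (PowerSeries.X ^ 2 *
        (arcsinhSer Jp * PowerSeries.C W - PowerSeries.C W * arcsinhSer Jp)) := by
    rw [Yser, ← hW, mul_sub, sub_mul, mul_smul_comm, smul_mul_assoc, hx, mul_assoc, mul_sub,
      smul_sub]
    abel
  have hcoeff (c : ℂ) (f : PowerSeries A) (m : ℕ) :
      PowerSeries.coeff m (c • f) = c • PowerSeries.coeff m f := rfl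
  rw [hs]
  ext m
  rw [map_sub, hcoeff, PowerSeries.coeff_X_pow_mul', map_sub, map_sub, PowerSeries.coeff_mul_C,
    PowerSeries.coeff_C_mul, PowerSeries.coeff_mul_C, PowerSeries.coeff_C_mul, Hser,
    PowerSeries.coeff_mul_C]
  simp only [arcsinhSer, sqrtSer, PowerSeries.coeff_mk]
  obtain ⟨n, rfl | rfl⟩ := m.even_or_odd'
  · rcases n with _ | n
    · simp [qbinom, arcsinhCoeff, rel3]
    · have e1 : 2 * (n + 1) - 2 = 2 * n := by omega
      have e2 : 2 * (n + 1) / 2 = n + 1 := by omega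
      have e3 : 2 * n / 2 = n := by omega
      have hq := congrArg (Rat.cast : ℚ → ℂ) (qbinom_half_succ n)
      have ha := congrArg (Rat.cast : ℚ → ℂ) (arcsinhCoeff_succ n)
      push_cast at hq ha
      simp only [e1, e2, e3, Nat.mul_mod_right, if_true, smul_mul_assoc, mul_smul_comm, ← smul_sub,
        show 2 ≤ 2 * (n + 1) by omega,
        raising_pow_succ_commutator_lowering rel1 rel3, hW, raising_pow_commutator_cartan_sq rel1]
      rw [show 2 * n + 1 + 1 = 2 * (n + 1) by ring, ← nsmul_one (2 * (n + 1)),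
        ← nsmul_one (2 * n + 1)]
      simp only [mul_add, mul_smul_comm, mul_one]
      match_scalars
      · linear_combination -hq
      · linear_combination ha
  · have h1 : (2 * n + 1) % 2 = 1 := by omega
    have h2 (h : 2 ≤ 2 * n + 1) : (2 * n + 1 - 2) % 2 = 1 := by omega
    split_ifs <;> simp_all
end

section
/- Let A be an associative unital ℂ-algebra and H, B ∈ A with HB - BH = 2B. In the ring A[[t]] of formal power series in a central variable t, set L := -Σ_{k≥1} (2tB)ᵏ/k (the formal power series for log(1 - 2tB)). Then Σ_{n≥0} (1/(2ⁿ·n!))·Hⁿ·Lⁿ = Σ_{n≥0} ((-t)ⁿ/n!)·(HB)ⁿ; that is, the multiplication map applied to exp((1/2)·H ⊗ log(1 - 2tB)) equals exp(-t·HB). -/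
noncomputable section

/-- `L := log(1 - 2tB) = -Σ_{k≥1} (2tB)ᵏ/k` in `A[[t]]`. -/
def logSer {A : Type*} [Ring A] [Algebra ℂ A] (B : A) : PowerSeries A :=
  PowerSeries.mk fun m =>
    if m = 0 then 0 else (-(((2 : ℂ) ^ m) / (m : ℂ))) • B ^ m

/-- The scalar power series `log(1 - 2t)`. -/
def scalarLogSer : PowerSeries ℂ :=
  PowerSeries.mk fun m => if m = 0 then 0 else -(((2 : ℂ) ^ m) / (m : ℂ))

lemma coeff_logSer_pow {A : Type*} [Ring A] [Algebra ℂ A] (B : A) (n m : ℕ) :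
    PowerSeries.coeff m (logSer B ^ n) = PowerSeries.coeff m (scalarLogSer ^ n) • B ^ m := by
  induction n generalizing m with
  | zero =>
    rw [pow_zero, pow_zero, PowerSeries.coeff_one, PowerSeries.coeff_one]
    split_ifs with h <;> simp [h]
  | succ n ih =>
    rw [pow_succ, pow_succ, PowerSeries.coeff_mul, PowerSeries.coeff_mul, Finset.sum_smul]
    refine Finset.sum_congr rfl fun p hp => ?_
    rw [Finset.HasAntidiagonal.mem_antidiagonal] at hp
    rw [ih, logSer, scalarLogSer, PowerSeries.coeff_mk, PowerSeries.coeff_mk]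
    split_ifs with h
    · simp
    · rw [smul_mul_smul_comm, ← pow_add, hp]

lemma one_sub_mul_derivative_scalarLogSer :
    (1 - PowerSeries.C (2 : ℂ) * PowerSeries.X) * PowerSeries.derivative ℂ scalarLogSer =
      PowerSeries.C (-2 : ℂ) := by
  have hd (k : ℕ) : PowerSeries.coeff k (PowerSeries.derivative ℂ scalarLogSer) =
      -(2 : ℂ) ^ (k + 1) := by
    have : (k : ℂ) + 1 ≠ 0 := Nat.cast_add_one_ne_zero k
    rw [PowerSeries.coeff_derivative, scalarLogSer, PowerSeries.coeff_mk]
    simp only [Nat.add_eq_zero_iff, one_ne_zero, and_false, if_false]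
    push_cast
    field_simp
  ext m
  rw [sub_mul, one_mul, mul_assoc, map_sub, PowerSeries.coeff_C_mul, hd]
  cases m with
  | zero => simp
  | succ m =>
    rw [PowerSeries.coeff_succ_X_mul, hd, PowerSeries.coeff_C]
    simp only [Nat.add_eq_zero_iff, one_ne_zero, and_false, if_false]
    ring

lemma coeff_scalarLogSer_pow_succ (n m : ℕ) :
    ((m : ℂ) + 1) * PowerSeries.coeff (m + 1) (scalarLogSer ^ (n + 1)) =
      2 * m * PowerSeries.coeff m (scalarLogSer ^ (n + 1)) -
        2 * (n + 1) * PowerSeries.coeff m (scalarLogSer ^ n) := by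
  have h : (1 - PowerSeries.C (2 : ℂ) * PowerSeries.X) *
      PowerSeries.derivative ℂ (scalarLogSer ^ (n + 1)) =
        PowerSeries.C (-2 * ((n : ℂ) + 1)) * scalarLogSer ^ n := by
    rw [Derivation.leibniz_pow, map_mul, ← one_sub_mul_derivative_scalarLogSer]
    simp only [Nat.add_sub_cancel, smul_eq_mul, nsmul_eq_mul, map_add, map_natCast, map_one,
      Nat.cast_add, Nat.cast_one]
    ring
  have hm := congrArg (PowerSeries.coeff m) h
  rw [sub_mul, one_mul, mul_assoc, map_sub, PowerSeries.coeff_C_mul, PowerSeries.coeff_C_mul,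
    PowerSeries.coeff_derivative] at hm
  cases m with
  | zero =>
    simp only [PowerSeries.coeff_zero_X_mul] at hm
    push_cast at hm ⊢
    linear_combination hm
  | succ m =>
    rw [PowerSeries.coeff_succ_X_mul, PowerSeries.coeff_derivative] at hm
    push_cast at hm ⊢
    linear_combination hm

lemma coeff_scalarLogSer_pow_of_lt {n m : ℕ} (h : m < n) :
    PowerSeries.coeff m (scalarLogSer ^ n) = 0 :=
  PowerSeries.coeff_of_lt_order _ <| lt_of_lt_of_le (by exact_mod_cast h) <|
    PowerSeries.le_order_pow_of_constantCoeff_eq_zero n (by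
      rw [← PowerSeries.coeff_zero_eq_constantCoeff_apply, scalarLogSer, PowerSeries.coeff_mk,
        if_pos rfl])

/-- The coefficient of `t ^ m` in `exp((h / 2) log(1 - 2t))`, for `h` in a `ℂ`-algebra. -/
def expLogCoeff {A : Type*} [Ring A] [Algebra ℂ A] (H : A) (m : ℕ) : A :=
  ∑ n ∈ Finset.range (m + 1),
    (1 / ((2 : ℂ) ^ n * (n.factorial : ℂ)) * PowerSeries.coeff m (scalarLogSer ^ n)) • H ^ n

lemma expLogCoeff_succ {A : Type*} [Ring A] [Algebra ℂ A] (H : A) (m : ℕ) :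
    ((m : ℂ) + 1) • expLogCoeff H (m + 1) =
      expLogCoeff H m * ((2 * (m : ℂ)) • (1 : A) - H) := by
  have hshift : (2 * (m : ℂ)) • expLogCoeff H m = ∑ n ∈ Finset.range (m + 1),
      (2 * (m : ℂ) * (1 / ((2 : ℂ) ^ (n + 1) * ((n + 1).factorial : ℂ)) *
        PowerSeries.coeff m (scalarLogSer ^ (n + 1)))) • H ^ (n + 1) := by
    have hext : expLogCoeff H m = ∑ n ∈ Finset.range (m + 2),
        (1 / ((2 : ℂ) ^ n * (n.factorial : ℂ)) *
          PowerSeries.coeff m (scalarLogSer ^ n)) • H ^ n := by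
      rw [Finset.sum_range_succ, coeff_scalarLogSer_pow_of_lt (Nat.lt_succ_self m), mul_zero,
        zero_smul, add_zero, expLogCoeff]
    rw [hext, Finset.sum_range_succ', smul_add, Finset.smul_sum]
    simp only [smul_smul]
    rw [pow_zero scalarLogSer, PowerSeries.coeff_one]
    rcases Nat.eq_zero_or_pos m with rfl | hm
    · simp
    · simp [hm.ne']
  rw [mul_sub, mul_smul_comm, mul_one, hshift, expLogCoeff, expLogCoeff, Finset.sum_range_succ',
    smul_add, Finset.smul_sum, Finset.sum_mul, ← Finset.sum_sub_distrib, pow_zero scalarLogSer,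
    PowerSeries.coeff_one, if_neg (Nat.succ_ne_zero m), mul_zero, zero_smul, smul_zero, add_zero]
  refine Finset.sum_congr rfl fun n _ => ?_
  rw [smul_mul_assoc, ← pow_succ, ← sub_smul, smul_smul]
  congr 1
  have hn : (n : ℂ) + 1 ≠ 0 := Nat.cast_add_one_ne_zero n
  have hf : (n.factorial : ℂ) ≠ 0 := Nat.cast_ne_zero.mpr n.factorial_ne_zero
  rw [mul_left_comm, coeff_scalarLogSer_pow_succ, Nat.factorial_succ]
  push_cast
  field_simp
  ring

lemma smul_one_sub_mul_pow {A : Type*} [Ring A] [Algebra ℂ A] {H B : A}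
    (rel : H * B - B * H = 2 * B) (m : ℕ) :
    ((2 * (m : ℂ)) • (1 : A) - H) * B ^ m = -(B ^ m * H) := by
  induction m with
  | zero => simp
  | succ m ih =>
    have hHB : H * B = B * H + (2 : ℂ) • B := by
      rw [sub_eq_iff_eq_add'.mp rel, two_mul, two_smul]
    rw [sub_mul, smul_mul_assoc, one_mul, sub_eq_iff_eq_add] at ih
    have hH : H * B ^ m = (2 * (m : ℂ)) • B ^ m + B ^ m * H := by rw [ih]; abel
    rw [sub_mul, smul_mul_assoc, one_mul, pow_succ, ← mul_assoc H, hH, add_mul, mul_assoc _ H,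
      hHB, mul_add, smul_mul_assoc, mul_smul_comm, mul_assoc _ B H]
    push_cast
    module

lemma expLogCoeff_mul_pow {A : Type*} [Ring A] [Algebra ℂ A] {H B : A}
    (rel : H * B - B * H = 2 * B) (m : ℕ) :
    expLogCoeff H m * B ^ m = (((-1 : ℂ) ^ m) / (m.factorial : ℂ)) • (H * B) ^ m := by
  induction m with
  | zero => simp [expLogCoeff]
  | succ m ih =>
    have hm : (m : ℂ) + 1 ≠ 0 := Nat.cast_add_one_ne_zero m
    have hf : (m.factorial : ℂ) ≠ 0 := Nat.cast_ne_zero.mpr m.factorial_ne_zero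
    refine (smul_right_injective A hm) ?_
    change ((m : ℂ) + 1) • _ = ((m : ℂ) + 1) • _
    rw [← smul_mul_assoc, expLogCoeff_succ, pow_succ B, mul_assoc, ← mul_assoc _ (B ^ m),
      smul_one_sub_mul_pow rel, neg_mul, mul_neg, mul_assoc (B ^ m), ← mul_assoc, ih,
      smul_mul_assoc, ← pow_succ, smul_smul, ← neg_smul]
    congr 1
    rw [Nat.factorial_succ]
    push_cast
    field_simp
    ring

/-- The disentanglement formula for the classical `sl(2)` Borel generators: if
`HB - BH = 2B` then `Σ_{n≥0} (1/(2ⁿn!))HⁿLⁿ = Σ_{n≥0} ((-t)ⁿ/n!)(HB)ⁿ` in `A[[t]]`,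
where `L = log(1 - 2tB)`; i.e. `μ[exp((1/2)H ⊗ log(1-2tB))] = exp(-t·HB)`.  The
left-hand side is well defined since `L` has zero constant term (the degree-`m`
coefficient only receives contributions from `n ≤ m`). -/
theorem statement_16 (A : Type*) [Ring A] [Algebra ℂ A] (H B : A)
    (rel : H * B - B * H = 2 * B) :
    (PowerSeries.mk fun m =>
        PowerSeries.coeff m
          (∑ n ∈ Finset.range (m + 1),
            ((1 / ((2 : ℂ) ^ n * (n.factorial : ℂ))) •
              (PowerSeries.C (H ^ n) * (logSer B) ^ n)))) =
      PowerSeries.mk fun m =>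
        (((-1 : ℂ) ^ m) / (m.factorial : ℂ)) • (H * B) ^ m := by
  ext m
  rw [PowerSeries.coeff_mk, PowerSeries.coeff_mk, ← expLogCoeff_mul_pow rel, expLogCoeff,
    Finset.sum_mul, map_sum]
  refine Finset.sum_congr rfl fun n _ => ?_
  rw [PowerSeries.coeff_smul, PowerSeries.coeff_C_mul, coeff_logSer_pow, mul_smul_comm,
    smul_smul, smul_mul_assoc]
end
end

section
/- Fix h ∈ ℂ. As q → 1 (q ∈ ℂ, q ≠ 1, q ≠ 0), the 9×9 matrices G(q)⁻¹·R_q·G(q) converge to the 9×9 matrix R_h whose diagonal entries are all 1 and whose only nonzero off-diagonal entries are (R_h)₁₂ = h, (R_h)₁₄ = -h, (R_h)₁₅ = h², (R_h)₂₅ = h, (R_h)₄₅ = -h. (This is the contraction producing the nonstandard R-matrix of U_h(sl(2|1)) in the fundamental ⊗ fundamental representation.) -/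
noncomputable section

open Matrix
open scoped Kronecker Topology

/-- The R-matrix of the Drinfeld–Jimbo quantum superalgebra `U_q(sl(2|1))` in the
fundamental ⊗ fundamental representation (9×9, 0-based indices). -/
def Rq (q : ℂ) : Matrix (Fin 9) (Fin 9) ℂ :=
  Matrix.of fun i j =>
    if i = j then
      (if i = 0 ∨ i = 4 then q else if i = 8 then (q⁻¹) ^ 2 else 1)
    else if (i, j) = (1, 3) ∨ (i, j) = (2, 6) ∨ (i, j) = (5, 7) then q - q⁻¹
    else 0

/-- `M(q) := I₃ + (h/(q-1))·E₁₂`. -/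
def Mq (h q : ℂ) : Matrix (Fin 3) (Fin 3) ℂ :=
  1 + (h / (q - 1)) • Matrix.single 0 1 1

/-- `G(q) := M(q) ⊗ M(q)`, the Kronecker product, as a 9×9 matrix (row-major
reindexing of `Fin 3 × Fin 3`). -/
def Gq (h q : ℂ) : Matrix (Fin 9) (Fin 9) ℂ :=
  Matrix.reindex finProdFinEquiv finProdFinEquiv (Mq h q ⊗ₖ Mq h q)

/-- The nonstandard (Jordanian) R-matrix `R_h` of `U_h(sl(2|1))` in the fundamental ⊗
fundamental representation: all diagonal entries `1`, and the only nonzero off-diagonal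
entries are `(R_h)₁₂ = h`, `(R_h)₁₄ = -h`, `(R_h)₁₅ = h²`, `(R_h)₂₅ = h`, `(R_h)₄₅ = -h`
(1-based indexing). -/
def Rh (h : ℂ) : Matrix (Fin 9) (Fin 9) ℂ :=
  Matrix.of fun i j =>
    if i = j then 1
    else if (i, j) = (0, 1) then h
    else if (i, j) = (0, 3) then -h
    else if (i, j) = (0, 4) then h ^ 2
    else if (i, j) = (1, 4) then h
    else if (i, j) = (3, 4) then -h
    else 0

/-- The conjugate `G(q)⁻¹·R_q·G(q)` in closed form, with the pole at `q = 1` cancelled. -/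
def conjRq (h q : ℂ) : Matrix (Fin 9) (Fin 9) ℂ :=
  !![q, h, 0, -h / q, h ^ 2 / q, 0, 0, 0, 0;
    0, 1, 0, q - q⁻¹, h / q, 0, 0, 0, 0;
    0, 0, 1, 0, 0, 0, q - q⁻¹, 0, 0;
    0, 0, 0, 1, -h, 0, 0, 0, 0;
    0, 0, 0, 0, q, 0, 0, 0, 0;
    0, 0, 0, 0, 0, 1, 0, q - q⁻¹, 0;
    0, 0, 0, 0, 0, 0, 1, 0, 0;
    0, 0, 0, 0, 0, 0, 0, 1, 0;
    0, 0, 0, 0, 0, 0, 0, 0, (q⁻¹) ^ 2]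

theorem Mq_mul_Mq_neg (h q : ℂ) : Mq h q * Mq (-h) q = 1 := by
  simp [Mq, mul_add, add_mul, neg_div]

theorem Gq_mul_Gq_neg (h q : ℂ) : Gq h q * Gq (-h) q = 1 := by
  simp only [Gq, Matrix.reindex_apply, Matrix.submatrix_mul_equiv, ← Matrix.mul_kronecker_mul,
    Mq_mul_Mq_neg, Matrix.one_kronecker_one, Matrix.submatrix_one_equiv]

theorem Gq_eq (h q t : ℂ) (ht : h / (q - 1) = t) : Gq h q =
    !![1, t, 0, t, t ^ 2, 0, 0, 0, 0;
      0, 1, 0, 0, t, 0, 0, 0, 0;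
      0, 0, 1, 0, 0, t, 0, 0, 0;
      0, 0, 0, 1, t, 0, 0, 0, 0;
      0, 0, 0, 0, 1, 0, 0, 0, 0;
      0, 0, 0, 0, 0, 1, 0, 0, 0;
      0, 0, 0, 0, 0, 0, 1, t, 0;
      0, 0, 0, 0, 0, 0, 0, 1, 0;
      0, 0, 0, 0, 0, 0, 0, 0, 1] := by
  ext i j
  fin_cases i <;> fin_cases j <;>
    simp [Gq, Mq, ht, finProdFinEquiv, Fin.divNat, Fin.modNat, sq]

theorem Rq_mul_Gq (h : ℂ) {q : ℂ} (hq : q ≠ 0) (hq1 : q ≠ 1) :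
    Rq q * Gq h q = Gq h q * conjRq h q := by
  obtain ⟨t, rfl⟩ : ∃ t, h = t * (q - 1) := ⟨h / (q - 1), by field_simp [sub_ne_zero.2 hq1]⟩
  rw [Gq_eq _ q t (mul_div_cancel_right₀ t (sub_ne_zero.2 hq1))]
  ext i j
  fin_cases i <;> fin_cases j <;>
    simp [Matrix.mul_apply, Fin.sum_univ_succ, Rq, conjRq] <;> field_simp <;> ring

theorem conjRq_eq (h : ℂ) {q : ℂ} (hq : q ≠ 0) (hq1 : q ≠ 1) :
    (Gq h q)⁻¹ * Rq q * Gq h q = conjRq h q := by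
  rw [Matrix.mul_assoc, Rq_mul_Gq h hq hq1, ← Matrix.mul_assoc, Matrix.nonsing_inv_mul,
    Matrix.one_mul]
  exact Matrix.isUnit_det_of_right_inverse (Gq_mul_Gq_neg h q)

theorem conjRq_one (h : ℂ) : conjRq h 1 = Rh h := by
  ext i j
  fin_cases i <;> fin_cases j <;> simp [conjRq, Rh]

theorem continuousAt_conjRq (h : ℂ) {q : ℂ} (hq : q ≠ 0) : ContinuousAt (conjRq h) q := by
  refine continuousAt_pi.2 fun i => continuousAt_pi.2 fun j => ?_
  fin_cases i <;> fin_cases j <;> simp [conjRq, -inv_pow] <;> fun_prop (disch := assumption)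

/-- Contraction producing the nonstandard R-matrix of `U_h(sl(2|1))`:
`G(q)⁻¹·R_q·G(q) → R_h` as `q → 1` (along the punctured-neighborhood filter at `1`). -/
theorem statement_17 (h : ℂ) :
    Filter.Tendsto (fun q : ℂ => (Gq h q)⁻¹ * Rq q * Gq h q)
      (𝓝[≠] (1 : ℂ)) (𝓝 (Rh h)) := by
  rw [← conjRq_one]
  refine ((continuousAt_conjRq h one_ne_zero).tendsto.mono_left nhdsWithin_le_nhds).congr' ?_
  filter_upwards [self_mem_nhdsWithin, nhdsWithin_le_nhds (isOpen_ne.mem_nhds one_ne_zero)]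
    with q hq1 hq
  exact (conjRq_eq h hq hq1).symm
end
end
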